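/- (Bressoud's identity) For all integers M ≥ 0: Σ_{j∈ℤ} (-1)^j q^{j(5j+1)/2} [2M choose M-2j] = Σ_{n=0}^M q^{n²} [M choose n]. -/

import Mathlib

open Finset

noncomputable section

/-- The field of rational functions over ℚ in which the identities are stated. -/
abbrev K : Type := RatFunc ℚ

/-- The variable. -/
def tq : K := RatFunc.X

/-- Gaussian binomial coefficient `[n choose k]` in the variable `p`:
`∏_{j=1}^{k} (1 - p^(n-k+j))/(1 - p^j)` when `0 ≤ k ≤ n`, and `0` otherwise. -/
def gb (p : K) (n k : ℤ) : K :=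
  if 0 ≤ k ∧ k ≤ n then
    ∏ j ∈ Finset.range k.toNat, (1 - p ^ (n - k + 1 + (j : ℤ))) / (1 - p ^ (1 + (j : ℤ)))
  else 0

/-- The `q`-factorial `(q;q)_n`. -/
def qFactorial (n : ℕ) : K := ∏ i ∈ range n, (1 - tq ^ (i + 1))

lemma tq_ne_zero : tq ≠ 0 := RatFunc.X_ne_zero

lemma one_sub_tq_pow_ne_zero (n : ℕ) : 1 - tq ^ (n + 1) ≠ 0 := by
  intro h
  have h1 : algebraMap (Polynomial ℚ) K (Polynomial.X ^ (n + 1)) = algebraMap _ K 1 := by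
    rw [map_pow, map_one, RatFunc.algebraMap_X]
    exact (sub_eq_zero.mp h).symm
  have h2 := congrArg Polynomial.natDegree (RatFunc.algebraMap_injective ℚ h1)
  simp at h2

lemma qFactorial_succ (n : ℕ) :
    qFactorial (n + 1) = qFactorial n * (1 - tq ^ (n + 1)) := by
  simp [qFactorial, prod_range_succ]

lemma qFactorial_ne_zero (n : ℕ) : qFactorial n ≠ 0 :=
  prod_ne_zero_iff.mpr fun i _ => one_sub_tq_pow_ne_zero i

lemma qFactorial_add (a b : ℕ) :
    qFactorial (a + b) = qFactorial a * ∏ j ∈ range b, (1 - tq ^ (a + 1 + j)) := by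
  simp only [qFactorial, prod_range_add]
  congr 1
  exact prod_congr rfl fun j _ => by ring_nf

lemma gb_add (a b : ℕ) :
    gb tq ((a : ℤ) + b) b = qFactorial (a + b) / (qFactorial a * qFactorial b) := by
  have hnum : ∀ j : ℕ, tq ^ ((a : ℤ) + b - b + 1 + (j : ℤ)) = tq ^ (a + 1 + j) := fun j => by
    rw [← zpow_natCast]; congr 1; push_cast; ring
  have hden : ∀ j : ℕ, tq ^ (1 + (j : ℤ)) = tq ^ (j + 1) := fun j => by
    rw [← zpow_natCast]; congr 1; push_cast; ring
  rw [gb, if_pos (by omega), Int.toNat_natCast, prod_div_distrib, qFactorial_add,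
    mul_div_mul_left _ _ (qFactorial_ne_zero a)]
  simp only [hnum, hden, qFactorial]

lemma gb_eq_zero {n k : ℤ} (h : k < 0 ∨ n < k) : gb tq n k = 0 :=
  if_neg (by omega)

lemma gb_zero_right {n : ℤ} (h : 0 ≤ n) : gb tq n 0 = 1 := by
  simp [gb, h]

lemma gb_symm (n k : ℤ) : gb tq n (n - k) = gb tq n k := by
  by_cases h : 0 ≤ k ∧ k ≤ n
  · obtain ⟨b, rfl⟩ := Int.eq_ofNat_of_zero_le h.1
    obtain ⟨a, ha⟩ := Int.eq_ofNat_of_zero_le (sub_nonneg.mpr h.2)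
    obtain rfl : n = (a : ℤ) + b := by omega
    rw [gb_add, add_sub_cancel_right, add_comm (a : ℤ), gb_add, add_comm b, mul_comm]
  · rw [gb_eq_zero (by omega), gb_eq_zero (by omega)]

lemma gb_self {n : ℤ} (h : 0 ≤ n) : gb tq n n = 1 := by
  rw [← gb_symm, sub_self, gb_zero_right h]

lemma gb_succ {n : ℤ} (hn : 0 ≤ n) (k : ℤ) :
    gb tq (n + 1) k = gb tq n (k - 1) + tq ^ k * gb tq n k := by
  rcases lt_trichotomy k 0 with hk | rfl | hk
  · simp [gb_eq_zero (n := n + 1) (Or.inl hk), gb_eq_zero (n := n) (Or.inl hk),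
      gb_eq_zero (n := n) (k := k - 1) (by omega)]
  · rw [gb_zero_right (by omega), gb_zero_right hn, gb_eq_zero (by omega)]
    simp
  rcases lt_trichotomy k (n + 1) with hkn | rfl | hkn
  · obtain ⟨b, hb⟩ := Int.eq_ofNat_of_zero_le (show 0 ≤ k - 1 by omega)
    obtain ⟨a, ha⟩ := Int.eq_ofNat_of_zero_le (show 0 ≤ n - k by omega)
    obtain rfl : k = ((b + 1 : ℕ) : ℤ) := by omega
    obtain rfl : n = (a : ℤ) + ((b + 1 : ℕ) : ℤ) := by omega
    have h₁ := gb_add (a + 1) (b + 1)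
    have h₂ := gb_add (a + 1) b
    rw [show ((a + 1 : ℕ) : ℤ) + ((b + 1 : ℕ) : ℤ) = a + ((b + 1 : ℕ) : ℤ) + 1 by omega] at h₁
    rw [show ((a + 1 : ℕ) : ℤ) + b = a + ((b + 1 : ℕ) : ℤ) by omega] at h₂
    rw [h₁, gb_add a (b + 1), hb, h₂, zpow_natCast,
      show a + 1 + (b + 1) = a + b + 1 + 1 by omega, show a + 1 + b = a + b + 1 by omega,
      show a + (b + 1) = a + b + 1 by omega, qFactorial_succ (a + b + 1), qFactorial_succ a,
      qFactorial_succ b]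
    have := qFactorial_ne_zero a
    have := qFactorial_ne_zero b
    have := one_sub_tq_pow_ne_zero a
    have := one_sub_tq_pow_ne_zero b
    field_simp
    ring
  · rw [gb_self (by omega), add_sub_cancel_right, gb_self hn, gb_eq_zero (by omega)]
    simp
  · rw [gb_eq_zero (by omega), gb_eq_zero (by omega), gb_eq_zero (by omega)]
    simp

lemma gb_succ' {n : ℤ} (hn : 0 ≤ n) (k : ℤ) :
    gb tq (n + 1) k = gb tq n k + tq ^ (n + 1 - k) * gb tq n (k - 1) := by
  rw [← gb_symm, gb_succ hn, ← gb_symm n k, ← gb_symm n (k - 1),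
    show n + 1 - k - 1 = n - k by ring, show n - (k - 1) = n + 1 - k by ring]

lemma support_mul_gb_finite (c : ℤ → K) (n : ℤ) {g : ℤ → ℤ} (hg : g.Injective) :
    (Function.support fun j => c j * gb tq n (g j)).Finite := by
  refine ((Set.finite_Icc 0 n).preimage hg.injOn).subset fun j hj => ?_
  by_contra h
  rw [Set.mem_preimage, Set.mem_Icc] at h
  exact hj (by simp [gb_eq_zero (n := n) (k := g j) (by omega)])

lemma finsum_mul_gb_add (c d : ℤ → K) (m n : ℤ) {g h : ℤ → ℤ} (hg : g.Injective)
    (hh : h.Injective) :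
    ∑ᶠ j, (c j * gb tq m (g j) + d j * gb tq n (h j)) =
      ∑ᶠ j, c j * gb tq m (g j) + ∑ᶠ j, d j * gb tq n (h j) :=
  finsum_add_distrib (support_mul_gb_finite c m hg) (support_mul_gb_finite d n hh)

lemma sub_two_mul_injective (a : ℤ) : Function.Injective fun j : ℤ => a - 2 * j :=
  fun _ _ h => by simp only at h; omega

lemma sub_one_injective : Function.Injective fun j : ℤ => j - 1 :=
  fun _ _ h => by simp only at h; omega

/-- `∑ₙ q^(n²) [m choose n]`. -/
def squareSum (m : ℤ) : K := ∑ᶠ n : ℤ, tq ^ (n ^ 2) * gb tq m n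

/-- `∑ₙ q^(n²+n) [m choose n]`. -/
def pronicSum (m : ℤ) : K := ∑ᶠ n : ℤ, tq ^ (n ^ 2 + n) * gb tq m n

lemma squareSum_succ {m : ℤ} (hm : 0 ≤ m) :
    squareSum (m + 1) = squareSum m + tq ^ (m + 1) * pronicSum m := by
  have hterm : ∀ n : ℤ, tq ^ (n ^ 2) * gb tq (m + 1) n =
      tq ^ (n ^ 2) * gb tq m n + tq ^ (n ^ 2 + (m + 1 - n)) * gb tq m (n - 1) := fun n => by
    rw [gb_succ' hm, zpow_add₀ tq_ne_zero]; ring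
  simp only [squareSum, pronicSum, hterm]
  rw [finsum_mul_gb_add _ _ _ _ (g := fun n => n) Function.injective_id sub_one_injective,
    ← finsum_comp_equiv
    (Equiv.addRight (1 : ℤ)) (f := fun n => tq ^ (n ^ 2 + (m + 1 - n)) * gb tq m (n - 1)),
    mul_finsum]
  congr 1
  refine finsum_congr fun n => ?_
  simp only [Equiv.coe_addRight, add_sub_cancel_right, ← mul_assoc, ← zpow_add₀ tq_ne_zero]
  ring_nf

lemma pronicSum_succ {m : ℤ} (hm : 0 ≤ m) :
    pronicSum (m + 1) = tq ^ (m + 1) * squareSum (m + 1) + (1 - tq ^ (m + 1)) * pronicSum m := by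
  have hsq : ∀ n : ℤ, tq ^ (n ^ 2) * gb tq (m + 1) n =
      tq ^ (n ^ 2) * gb tq m (n - 1) + tq ^ (n ^ 2 + n) * gb tq m n := fun n => by
    rw [gb_succ hm, zpow_add₀ tq_ne_zero]; ring
  have hpr : ∀ n : ℤ, tq ^ (n ^ 2 + n) * gb tq (m + 1) n =
      tq ^ (n ^ 2 + n) * gb tq m n + tq ^ (m + 1) * tq ^ (n ^ 2) * gb tq m (n - 1) := fun n => by
    rw [gb_succ' hm, mul_add, ← mul_assoc, ← zpow_add₀ tq_ne_zero, ← zpow_add₀ tq_ne_zero]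
    ring_nf
  simp only [squareSum, pronicSum, hsq, hpr]
  rw [finsum_mul_gb_add _ _ _ _ (g := fun n => n) Function.injective_id sub_one_injective,
    finsum_mul_gb_add _ _ _ _ sub_one_injective (h := fun n => n) Function.injective_id]
  simp only [mul_assoc, ← mul_finsum]
  ring

/-- The alternating side of Bressoud's identity. -/
def evenAltSum (m : ℤ) : K :=
  ∑ᶠ j : ℤ, (-1 : K) ^ j * tq ^ ((j * (5 * j + 1)) / 2) * gb tq (2 * m) (m - 2 * j)

/-- The alternating sum that matches `pronicSum`. -/
def oddAltSum (m : ℤ) : K :=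
  ∑ᶠ j : ℤ, (-1 : K) ^ j * tq ^ ((j * (5 * j - 3)) / 2) * gb tq (2 * m + 1) (m + 1 - 2 * j)

lemma finsum_eq_zero_of_reflect {f : ℤ → K} (c : ℤ) (hf : ∀ j, f (c - j) = -f j) :
    ∑ᶠ j, f j = 0 := by
  have h := finsum_comp_equiv (Equiv.subLeft c) (f := f)
  simp only [Equiv.subLeft_apply, hf, finsum_neg_distrib] at h
  exact self_eq_neg.mp h.symm

lemma neg_one_zpow_sub (c j : ℤ) : (-1 : K) ^ (c - j) = (-1) ^ c * (-1) ^ j := by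
  rw [zpow_sub₀ (by simp), div_eq_mul_inv, ← inv_zpow, inv_neg_one]

lemma evenAltSum_succ {m : ℤ} (hm : 0 ≤ m) :
    evenAltSum (m + 1) = evenAltSum m + tq ^ (m + 1) * oddAltSum m := by
  have hsplit : ∀ j : ℤ, (-1 : K) ^ j * tq ^ ((j * (5 * j + 1)) / 2) *
      gb tq (2 * (m + 1)) (m + 1 - 2 * j) =
      (-1) ^ j * tq ^ ((j * (5 * j + 1)) / 2) * gb tq (2 * m + 1) (m - 2 * j) +
        tq ^ (m + 1) * ((-1) ^ j * tq ^ ((j * (5 * j - 3)) / 2)) *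
          gb tq (2 * m + 1) (m + 1 - 2 * j) := fun j => by
    have hexp : (j * (5 * j + 1)) / 2 + (m + 1 - 2 * j) = m + 1 + (j * (5 * j - 3)) / 2 := by
      rw [show j * (5 * j + 1) = j * (5 * j - 3) + 2 * (2 * j) by ring]
      omega
    have hpow := congrArg (tq ^ ·) hexp
    simp only [zpow_add₀ tq_ne_zero _ (m + 1 - 2 * j),
      zpow_add₀ tq_ne_zero (m + 1) (_ / 2)] at hpow
    rw [show 2 * (m + 1) = 2 * m + 1 + 1 by ring, gb_succ (by omega),
      show m + 1 - 2 * j - 1 = m - 2 * j by ring]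
    linear_combination (-1 : K) ^ j * gb tq (2 * m + 1) (m + 1 - 2 * j) * hpow
  have hsplit' : ∀ j : ℤ, (-1 : K) ^ j * tq ^ ((j * (5 * j + 1)) / 2) *
      gb tq (2 * m + 1) (m - 2 * j) =
      (-1) ^ j * tq ^ ((j * (5 * j + 1)) / 2) * gb tq (2 * m) (m - 2 * j) +
        (-1) ^ j * tq ^ ((j * (5 * j + 1)) / 2 + (m + 1 + 2 * j)) *
          gb tq (2 * m) (m - 1 - 2 * j) := fun j => by
    rw [gb_succ' (by omega), zpow_add₀ tq_ne_zero,
      show 2 * m + 1 - (m - 2 * j) = m + 1 + 2 * j by ring,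
      show m - 2 * j - 1 = m - 1 - 2 * j by ring]
    ring
  have hzero : ∑ᶠ j : ℤ, (-1 : K) ^ j * tq ^ ((j * (5 * j + 1)) / 2 + (m + 1 + 2 * j)) *
      gb tq (2 * m) (m - 1 - 2 * j) = 0 := by
    refine finsum_eq_zero_of_reflect (-1) fun j => ?_
    have hexp : ((-1 - j) * (5 * (-1 - j) + 1)) / 2 + (m + 1 + 2 * (-1 - j)) =
        (j * (5 * j + 1)) / 2 + (m + 1 + 2 * j) := by
      rw [show (-1 - j) * (5 * (-1 - j) + 1) = j * (5 * j + 1) + 2 * (4 * j + 2) by ring]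
      omega
    rw [hexp, neg_one_zpow_sub, ← gb_symm,
      show 2 * m - (m - 1 - 2 * (-1 - j)) = m - 1 - 2 * j by ring]
    simp
  simp only [evenAltSum, oddAltSum, hsplit]
  rw [finsum_mul_gb_add _ _ _ _ (sub_two_mul_injective m) (sub_two_mul_injective (m + 1))]
  simp only [hsplit']
  rw [finsum_mul_gb_add _ _ _ _ (sub_two_mul_injective m) (sub_two_mul_injective (m - 1)),
    hzero, add_zero, mul_finsum]
  simp only [mul_assoc]

lemma oddAltSum_succ {m : ℤ} (hm : 0 ≤ m) :
    oddAltSum (m + 1) =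
      tq ^ (m + 1) * evenAltSum (m + 1) + (1 - tq ^ (m + 1)) * oddAltSum m := by
  have hsplit : ∀ j : ℤ, (-1 : K) ^ j * tq ^ ((j * (5 * j - 3)) / 2) *
      gb tq (2 * (m + 1) + 1) (m + 1 + 1 - 2 * j) =
      (-1) ^ j * tq ^ ((j * (5 * j - 3)) / 2) * gb tq (2 * m + 1 + 1) (m + 2 - 2 * j) +
        tq ^ (m + 1) * ((-1) ^ j * tq ^ ((j * (5 * j + 1)) / 2)) *
          gb tq (2 * (m + 1)) (m + 1 - 2 * j) := fun j => by
    have hexp : (j * (5 * j - 3)) / 2 + (m + 1 + 2 * j) = m + 1 + (j * (5 * j + 1)) / 2 := by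
      rw [show j * (5 * j + 1) = j * (5 * j - 3) + 2 * (2 * j) by ring]
      omega
    have hpow := congrArg (tq ^ ·) hexp
    simp only [zpow_add₀ tq_ne_zero _ (m + 1 + 2 * j),
      zpow_add₀ tq_ne_zero (m + 1) (_ / 2)] at hpow
    rw [gb_succ' (by omega), show 2 * (m + 1) + 1 - (m + 1 + 1 - 2 * j) = m + 1 + 2 * j by ring,
      show m + 1 + 1 - 2 * j - 1 = m + 1 - 2 * j by ring,
      show m + 1 + 1 - 2 * j = m + 2 - 2 * j by ring,
      show 2 * m + 1 + 1 = 2 * (m + 1) by ring]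
    linear_combination (-1 : K) ^ j * gb tq (2 * (m + 1)) (m + 1 - 2 * j) * hpow
  have hsplit' : ∀ j : ℤ, (-1 : K) ^ j * tq ^ ((j * (5 * j - 3)) / 2) *
      gb tq (2 * m + 1 + 1) (m + 2 - 2 * j) =
      (-1) ^ j * tq ^ ((j * (5 * j - 3)) / 2) * gb tq (2 * m + 1) (m + 1 - 2 * j) +
        (-1) ^ j * tq ^ ((j * (5 * j - 3)) / 2 + (m + 2 - 2 * j)) *
          gb tq (2 * m + 1) (m + 2 - 2 * j) := fun j => by
    rw [gb_succ (by omega), zpow_add₀ tq_ne_zero,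
      show m + 2 - 2 * j - 1 = m + 1 - 2 * j by ring]
    ring
  have hreflect : ∑ᶠ j : ℤ, (-1 : K) ^ j * tq ^ ((j * (5 * j - 3)) / 2 + (m + 2 - 2 * j)) *
      gb tq (2 * m + 1) (m + 2 - 2 * j) = -(tq ^ (m + 1) * oddAltSum m) := by
    rw [← finsum_comp_equiv (Equiv.subLeft (1 : ℤ)), oddAltSum, mul_finsum, ← finsum_neg_distrib]
    refine finsum_congr fun j => ?_
    have hexp : ((1 - j) * (5 * (1 - j) - 3)) / 2 + (m + 2 - 2 * (1 - j)) =
        (m + 1) + (j * (5 * j - 3)) / 2 := by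
      rw [show (1 - j) * (5 * (1 - j) - 3) = j * (5 * j - 3) + 2 * (1 - 2 * j) by ring]
      omega
    rw [Equiv.subLeft_apply, hexp, neg_one_zpow_sub, zpow_add₀ tq_ne_zero, ← gb_symm,
      show 2 * m + 1 - (m + 2 - 2 * (1 - j)) = m + 1 - 2 * j by ring, zpow_one]
    ring
  rw [oddAltSum]
  simp only [hsplit]
  rw [finsum_mul_gb_add _ _ _ _ (sub_two_mul_injective (m + 2)) (sub_two_mul_injective (m + 1))]
  simp only [hsplit']
  rw [finsum_mul_gb_add _ _ _ _ (sub_two_mul_injective (m + 1)) (sub_two_mul_injective (m + 2)),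
    hreflect, ← oddAltSum]
  simp only [mul_assoc (tq ^ (m + 1)), ← mul_finsum]
  rw [← evenAltSum]
  ring

lemma altSums_eq (M : ℕ) : evenAltSum M = squareSum M ∧ oddAltSum M = pronicSum M := by
  induction M with
  | zero =>
    rw [evenAltSum, squareSum, oddAltSum, pronicSum]
    refine ⟨?_, ?_⟩ <;>
    · rw [finsum_eq_single _ 0 fun j hj => by rw [gb_eq_zero (by omega), mul_zero],
        finsum_eq_single _ 0 fun j hj => by rw [gb_eq_zero (by omega), mul_zero]]
      simp [gb_self]
  | succ M ih =>
    have hM : (0 : ℤ) ≤ M := M.cast_nonneg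
    rw [Nat.cast_succ, oddAltSum_succ hM, pronicSum_succ hM, evenAltSum_succ hM,
      squareSum_succ hM, ih.1, ih.2]
    exact ⟨rfl, rfl⟩

/-- Bressoud's identity:
`Σ_{j∈ℤ} (-1)^j q^{j(5j+1)/2} [2M choose M-2j] = Σ_{n=0}^M q^{n²} [M choose n]`
(terms with `|2j| > M` vanish). -/
theorem bressoud (M : ℕ) :
    ∑ j ∈ Finset.Icc (-(M : ℤ)) M,
      (-1 : K) ^ j * tq ^ ((j * (5 * j + 1)) / 2) * gb tq (2 * M) ((M : ℤ) - 2 * j) =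
      ∑ n ∈ Finset.range (M + 1), tq ^ ((n : ℤ) ^ 2) * gb tq M n := by
  have heven : evenAltSum M = ∑ j ∈ Finset.Icc (-(M : ℤ)) M,
      (-1 : K) ^ j * tq ^ ((j * (5 * j + 1)) / 2) * gb tq (2 * M) ((M : ℤ) - 2 * j) := by
    refine finsum_eq_sum_of_support_subset _ fun j hj => ?_
    by_contra h
    rw [mem_coe, mem_Icc] at h
    exact hj (by simp only [gb_eq_zero (n := 2 * M) (k := M - 2 * j) (by omega), mul_zero])
  have hsquare : squareSum M = ∑ n ∈ Finset.range (M + 1), tq ^ ((n : ℤ) ^ 2) * gb tq M n := by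
    rw [squareSum, ← sum_image (s := range (M + 1)) (g := ((↑) : ℕ → ℤ))
      (f := fun n : ℤ => tq ^ (n ^ 2) * gb tq M n) Nat.cast_injective.injOn]
    refine finsum_eq_sum_of_support_subset _ fun n hn => ?_
    rw [mem_coe, mem_image]
    by_contra h
    refine hn ?_
    have hout : n < 0 ∨ (M : ℤ) < n := by
      by_contra hin
      exact h ⟨n.toNat, mem_range.mpr (by omega), by omega⟩
    simp only [gb_eq_zero hout, mul_zero]
  rw [← heven, ← hsquare, (altSums_eq M).1]
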